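/- arXiv:1204.1754 — 6 statements merged into one kernel-verified Lean document; each statement's English description precedes it below -/
import Mathlib

section
/- Let b ≥ 1 and let X be a finite set of binary strings of length b with |X| = q ≥ 1. Then the number of unordered pairs {u, v} of distinct strings of X whose Hamming distance is exactly 1 is at most (q/2)·log₂ q. -/
open Finset in
/-- The number of ordered pairs in `X × Y` at Hamming distance one. -/
def hammingPairCount {ι : Type*} [Fintype ι] (X Y : Finset (ι → Bool)) : ℕ :=
  ∑ u ∈ X, #{v ∈ Y | hammingDist u v = 1}

section

open Finset

variable {ι : Type*} [Fintype ι]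

theorem hammingPairCount_comm (X Y : Finset (ι → Bool)) :
    hammingPairCount X Y = hammingPairCount Y X := by
  simp only [hammingPairCount, card_filter]
  rw [sum_comm]
  simp only [hammingDist_comm]

theorem hammingPairCount_filter_add_filter_not (X Y : Finset (ι → Bool))
    (p : (ι → Bool) → Prop) [DecidablePred p] :
    hammingPairCount (X.filter p) Y + hammingPairCount (X.filter (¬ p ·)) Y =
      hammingPairCount X Y :=
  sum_filter_add_sum_filter_not X p _

/-- Two strings at Hamming distance one that differ at `i` agree everywhere else. -/
theorem eq_of_hammingDist_eq_one {u v : ι → Bool} (h : hammingDist u v = 1) {i : ι}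
    (hi : u i ≠ v i) {j : ι} (hj : j ≠ i) : u j = v j := by
  by_contra hne
  exact hj (card_le_one.1 h.le j (by simpa using hne) i (by simpa using hi))

theorem hammingPairCount_le_card (X Y : Finset (ι → Bool)) (i : ι)
    (h : ∀ u ∈ X, ∀ v ∈ Y, u i ≠ v i) : hammingPairCount X Y ≤ #X := by
  rw [hammingPairCount, card_eq_sum_ones]
  refine sum_le_sum fun u hu => card_le_one.2 fun v hv w hw => ?_
  rw [mem_filter] at hv hw
  funext j
  by_cases hj : j = i
  · subst hj
    have h1 := h u hu v hv.1
    have h2 := h u hu w hw.1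
    revert h1 h2
    cases u j <;> cases v j <;> cases w j <;> simp
  · rw [← eq_of_hammingDist_eq_one hv.2 (h u hu v hv.1) hj,
      eq_of_hammingDist_eq_one hw.2 (h u hu w hw.1) hj]

theorem mul_logb_two_add_le {a c : ℝ} (ha : 0 < a) (hac : a ≤ c) :
    a * Real.logb 2 a + c * Real.logb 2 c + 2 * a ≤ (a + c) * Real.logb 2 (a + c) := by
  have hc : 0 < c := ha.trans_le hac
  have h1 : Real.logb 2 a + 1 ≤ Real.logb 2 (a + c) := by
    rw [← Real.logb_self_eq_one (b := 2) (by norm_num), ← Real.logb_mul ha.ne' (by norm_num)]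
    exact Real.logb_le_logb_of_le (by norm_num) (by positivity) (by linarith)
  have h2 : Real.logb 2 c + a / c ≤ Real.logb 2 (a + c) := by
    have hpow : (2 : ℝ) ^ (a / c) ≤ 1 + a / c := by
      have := rpow_one_add_le_one_add_mul_self (s := 1) (by norm_num)
        (div_nonneg ha.le hc.le) ((div_le_one hc).2 hac)
      norm_num at this
      exact this
    have hsum : a + c = c * (1 + a / c) := by field_simp; ring
    rw [hsum, Real.logb_mul hc.ne' (by positivity), add_le_add_iff_left,
      Real.le_logb_iff_rpow_le (by norm_num) (by positivity)]
    exact hpow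
  have h3 := mul_le_mul_of_nonneg_left h1 ha.le
  have h4 := mul_le_mul_of_nonneg_left h2 hc.le
  have h5 : c * (a / c) = a := mul_div_cancel₀ a hc.ne'
  linarith

theorem mul_logb_two_add_min_le {a c : ℝ} (ha : 0 < a) (hc : 0 < c) :
    a * Real.logb 2 a + c * Real.logb 2 c + 2 * min a c ≤ (a + c) * Real.logb 2 (a + c) := by
  rcases le_total a c with h | h
  · rw [min_eq_left h]
    exact mul_logb_two_add_le ha h
  · rw [min_eq_right h, add_comm a c, add_comm (a * _)]
    exact mul_logb_two_add_le hc h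

/-- Edge-isoperimetric inequality on the Boolean cube, counting ordered pairs. -/
theorem hammingPairCount_self_le (X : Finset (ι → Bool)) :
    (hammingPairCount X X : ℝ) ≤ #X * Real.logb 2 #X := by
  induction X using Finset.strongInduction with
  | H X ih =>
  by_cases hX : #X ≤ 1
  · have h0 : hammingPairCount X X = 0 := by
      refine sum_eq_zero fun u hu => card_eq_zero.2 (filter_eq_empty_iff.2 fun v hv => ?_)
      rw [card_le_one.1 hX u hu v hv, hammingDist_self]
      exact zero_ne_one
    rw [h0, Nat.cast_zero]
    interval_cases #X <;> simp
  · obtain ⟨u, hu, v, hv, huv⟩ := one_lt_card.1 (not_le.1 hX)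
    obtain ⟨i, hi⟩ := Function.ne_iff.1 huv
    set A := X.filter (· i = u i) with hA
    set B := X.filter (¬ · i = u i) with hB
    have huA : u ∈ A := by simp [hA, hu]
    have hvB : v ∈ B := by simp [hB, hv, hi.symm]
    have hAX : A ⊂ X := filter_ssubset.2 ⟨v, hv, hi.symm⟩
    have hBX : B ⊂ X := filter_ssubset.2 ⟨u, hu, by simp⟩
    have hcard : #A + #B = #X := card_filter_add_card_filter_not _
    have hne : ∀ x ∈ A, ∀ y ∈ B, x i ≠ y i := fun x hx y hy h =>
      (mem_filter.1 hy).2 (h ▸ (mem_filter.1 hx).2)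
    have hcross : hammingPairCount A B ≤ min #A #B :=
      le_min (hammingPairCount_le_card A B i hne) (hammingPairCount_comm A B ▸
        hammingPairCount_le_card B A i fun y hy x hx => (hne x hx y hy).symm)
    have hsplit : hammingPairCount X X =
        hammingPairCount A A + hammingPairCount B B + 2 * hammingPairCount A B := by
      have h (Y) : hammingPairCount A Y + hammingPairCount B Y = hammingPairCount X Y :=
        hammingPairCount_filter_add_filter_not X Y (· i = u i)
      rw [← h X, hammingPairCount_comm A X, hammingPairCount_comm B X, ← h A, ← h B,
        hammingPairCount_comm B A]
      ring
    have hnum := mul_logb_two_add_min_le (a := #A) (c := #B)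
      (by exact_mod_cast card_pos.2 ⟨u, huA⟩) (by exact_mod_cast card_pos.2 ⟨v, hvB⟩)
    have hcross' : (hammingPairCount A B : ℝ) ≤ min (#A : ℝ) #B := by exact_mod_cast hcross
    rw [hsplit, ← hcard]
    push_cast
    linarith [ih A hAX, ih B hBX]

theorem two_mul_card_sym2_filter_le (X : Finset (ι → Bool)) :
    2 * #(X.sym2.filter (fun s =>
        Sym2.lift ⟨fun u v => hammingDist u v, fun u v => hammingDist_comm u v⟩ s = 1)) ≤
      hammingPairCount X X := by
  classical
  have hcount : hammingPairCount X X =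
      #((X ×ˢ X).filter fun p => hammingDist p.1 p.2 = 1) := by
    simp only [hammingPairCount, card_filter, sum_product]
  rw [hcount]
  refine mul_card_image_le_card_of_maps_to (f := fun p : _ × _ => s(p.1, p.2)) ?_ 2 ?_
  · simp
  · rintro ⟨u, v⟩ hs
    simp only [mem_filter, Sym2.lift_mk, mk_mem_sym2_iff] at hs
    obtain ⟨⟨hu, hv⟩, huv⟩ := hs
    have hne : u ≠ v := by
      rintro rfl
      simp at huv
    refine one_lt_card.2 ⟨(u, v), ?_, (v, u), ?_, by simp [hne]⟩
    · simp [hu, hv, huv]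
    · simp [hu, hv, hammingDist_comm v u, huv]

end

/-- Lemma 3.1: a set `X` of `q ≥ 1` binary strings of length `b ≥ 1` contains at most
`(q/2)·log₂ q` unordered pairs of strings at Hamming distance exactly 1. -/
theorem hamming_distance_one_output_bound (b q : ℕ) (hb : 1 ≤ b) (hq : 1 ≤ q)
    (X : Finset (Fin b → Bool)) (hX : X.card = q) :
    ((X.sym2.filter (fun s =>
        Sym2.lift ⟨fun u v => hammingDist u v, fun u v => hammingDist_comm u v⟩ s = 1)).card : ℝ)
      ≤ (q : ℝ) / 2 * Real.logb 2 q := by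
  have h1 := hammingPairCount_self_le X
  have h2 := Nat.cast_le (α := ℝ).2 (two_mul_card_sym2_filter_le X)
  push_cast at h2
  rw [hX] at h1
  linarith
end

section
/- For all real numbers y and z with 0 < y ≤ z, the inequality (y/2)·log₂ y + (z/2)·log₂ z + y ≤ ((y+z)/2)·log₂(y+z) holds. -/
/-- The sum of the values of a convex function at two points grows when the points are spread
apart with their sum kept fixed. -/
theorem ConvexOn.add_le_add_of_spread {s : Set ℝ} {f : ℝ → ℝ} (hf : ConvexOn ℝ s f)
    {a d e : ℝ} (hd : 0 ≤ d) (hde : d ≤ e) (he : 0 < e) (ha : a ∈ s) (hae : a + e ∈ s) :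
    f (a + d) + f (a + e - d) ≤ f a + f (a + e) := by
  have ht : 0 ≤ d / e := by positivity
  have ht' : 0 ≤ 1 - d / e := sub_nonneg.2 ((div_le_one he).2 hde)
  have h₁ := hf.2 ha hae ht' ht (by ring)
  have h₂ := hf.2 ha hae ht ht' (by ring)
  simp only [smul_eq_mul] at h₁ h₂
  rw [show (1 - d / e) * a + d / e * (a + e) = a + d by field_simp; ring] at h₁
  rw [show d / e * a + (1 - d / e) * (a + e) = a + e - d by field_simp; ring] at h₂
  linarith

/-- The analytic inequality (Equation 1) in the inductive step of Lemma 3.1: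
for `0 < y ≤ z`, `(y/2)·log₂ y + (z/2)·log₂ z + y ≤ ((y+z)/2)·log₂(y+z)`. -/
theorem log_inequality (y z : ℝ) (hy : 0 < y) (hyz : y ≤ z) :
    y / 2 * Real.logb 2 y + z / 2 * Real.logb 2 z + y ≤ (y + z) / 2 * Real.logb 2 (y + z) := by
  have hz : 0 < z := hy.trans_le hyz
  have h := Real.convexOn_mul_log.add_le_add_of_spread hy.le hyz hz
    (Set.mem_Ici.2 hy.le) (Set.mem_Ici.2 (add_pos hy hz).le)
  simp only [add_sub_cancel_left, ← two_mul, Real.log_mul two_ne_zero hy.ne'] at h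
  have hlog : 0 < Real.log 2 := Real.log_pos one_lt_two
  simp only [Real.logb]
  field_simp
  linarith
end

section
/- Let b ≥ 1 and q ≥ 2. Suppose E₁, …, E_p are finitely many sets of binary strings of length b such that |Eᵢ| ≤ q for every i, and such that every unordered pair of binary strings of length b at Hamming distance exactly 1 is contained in some single Eᵢ. Then the replication rate r = (∑ᵢ |Eᵢ|) / 2^b satisfies r ≥ b / log₂ q. -/
open Finset

/-- `2 * min a c ≤ (a + c) log₂ (a + c) - a log₂ a - c log₂ c`, stated for `0 ≤ a ≤ c`. -/
lemma mul_logb_two_add_mul_logb_two_add_le {a c : ℝ} (ha : 0 ≤ a) (hac : a ≤ c) :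
    a * Real.logb 2 a + c * Real.logb 2 c + 2 * a ≤ (a + c) * Real.logb 2 (a + c) := by
  rcases ha.eq_or_lt with rfl | ha
  · simp
  have hc : 0 < c := ha.trans_le hac
  have h₁ : Real.logb 2 a + 1 ≤ Real.logb 2 (a + c) := by
    rw [← Real.logb_self_eq_one (b := 2) (by norm_num),
      ← Real.logb_mul ha.ne' (by norm_num)]
    exact Real.logb_le_logb_of_le (by norm_num) (by positivity) (by linarith)
  have h₂ : Real.logb 2 c + a / c ≤ Real.logb 2 (a + c) := by
    have hbern : (2 : ℝ) ^ (a / c) ≤ 1 + a / c := by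
      have h := rpow_one_add_le_one_add_mul_self (s := 1) (by norm_num)
        (div_nonneg ha.le hc.le) ((div_le_one hc).2 hac)
      norm_num at h
      exact h
    have hlog : a / c ≤ Real.logb 2 (1 + a / c) :=
      (Real.le_logb_iff_rpow_le (by norm_num) (by positivity)).2 hbern
    have hsum : a + c = c * (1 + a / c) := by field_simp; ring
    rw [hsum, Real.logb_mul hc.ne' (by positivity)]
    linarith
  have h₃ : c * (a / c) = a := mul_div_cancel₀ a hc.ne'
  nlinarith [mul_le_mul_of_nonneg_left h₁ ha.le, mul_le_mul_of_nonneg_left h₂ hc.le]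

section Hypercube

variable {ι : Type*} [DecidableEq ι]

/-- The point of the hypercube obtained from `u` by negating coordinate `i`. -/
def flipCoord (i : ι) (u : ι → Bool) : ι → Bool := Function.update u i (!u i)

@[simp] lemma flipCoord_self (i : ι) (u : ι → Bool) : flipCoord i u i = !u i := by
  simp [flipCoord]

lemma flipCoord_of_ne {i j : ι} (h : j ≠ i) (u : ι → Bool) : flipCoord i u j = u j := by
  simp [flipCoord, h]

@[simp] lemma flipCoord_flipCoord (i : ι) (u : ι → Bool) : flipCoord i (flipCoord i u) = u := by
  simp [flipCoord]

variable [Fintype ι]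

lemma hammingDist_flipCoord (i : ι) (u : ι → Bool) :
    hammingDist u (flipCoord i u) = 1 := by
  rw [hammingDist, card_eq_one]
  refine ⟨i, ?_⟩
  ext j
  by_cases h : j = i
  · subst h; simp
  · simp [flipCoord_of_ne h, h]

/-- The points of `S` whose neighbour in direction `i` also lies in `S`. -/
def pairedPoints (i : ι) (S : Finset (ι → Bool)) : Finset (ι → Bool) :=
  {u ∈ S | flipCoord i u ∈ S}

@[simp] lemma mem_pairedPoints {i : ι} {S : Finset (ι → Bool)} {u : ι → Bool} :
    u ∈ pairedPoints i S ↔ u ∈ S ∧ flipCoord i u ∈ S := by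
  simp [pairedPoints]

lemma card_pairedPoints_of_ne {i j : ι} (h : i ≠ j) (S : Finset (ι → Bool)) :
    #(pairedPoints j S) =
      #(pairedPoints j {u ∈ S | u i = true}) + #(pairedPoints j {u ∈ S | ¬ u i = true}) := by
  rw [← card_filter_add_card_filter_not (s := pairedPoints j S) (fun u ↦ u i = true)]
  congr 2 <;> ext u <;> simp [flipCoord_of_ne h] <;> tauto

lemma card_pairedPoints_filter_eq (i : ι) (S : Finset (ι → Bool)) :
    #{u ∈ pairedPoints i S | u i = true} = #{u ∈ pairedPoints i S | ¬ u i = true} := by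
  refine card_nbij' (flipCoord i) (flipCoord i) ?_ ?_ ?_ ?_ <;> intro u <;> simp <;> tauto

lemma card_pairedPoints_self_le (i : ι) (S : Finset (ι → Bool)) :
    #(pairedPoints i S) ≤ 2 * min #{u ∈ S | u i = true} #{u ∈ S | ¬ u i = true} := by
  have hsub : pairedPoints i S ⊆ S := filter_subset _ _
  have h₁ := card_le_card (filter_subset_filter (fun u ↦ u i = true) hsub)
  have h₂ := card_le_card (filter_subset_filter (fun u ↦ ¬ u i = true) hsub)
  have h₃ := card_pairedPoints_filter_eq i S
  have h₄ := card_filter_add_card_filter_not (s := pairedPoints i S) (fun u ↦ u i = true)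
  omega

/-- Edge-isoperimetric inequality in the hypercube: a set `S` spans at most
`|S| log₂ |S| / 2` edges. Each edge is counted here once from each of its endpoints. -/
theorem sum_card_pairedPoints_le (T : Finset ι) (S : Finset (ι → Bool)) :
    ((∑ i ∈ T, #(pairedPoints i S) : ℕ) : ℝ) ≤ #S * Real.logb 2 #S := by
  induction T using Finset.induction_on generalizing S with
  | empty =>
    rcases S.eq_empty_or_nonempty with rfl | hS
    · simp
    · have : (1 : ℝ) ≤ #S := by exact_mod_cast hS.card_pos
      have := Real.logb_nonneg (b := 2) (by norm_num) this
      simp only [sum_empty, Nat.cast_zero]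
      positivity
  | insert i T hi ih =>
    have hsplit : ∑ j ∈ T, #(pairedPoints j S) =
        ∑ j ∈ T, #(pairedPoints j {u ∈ S | u i = true}) +
          ∑ j ∈ T, #(pairedPoints j {u ∈ S | ¬ u i = true}) := by
      rw [← sum_add_distrib]
      exact sum_congr rfl fun j hj ↦ card_pairedPoints_of_ne (ne_of_mem_of_not_mem hj hi).symm S
    rw [sum_insert hi, hsplit]
    have ih₁ := ih {u ∈ S | u i = true}
    have ih₂ := ih {u ∈ S | ¬ u i = true}
    have hself := card_pairedPoints_self_le i S
    rw [← card_filter_add_card_filter_not (s := S) (fun u ↦ u i = true)]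
    generalize #{u ∈ S | u i = true} = a at *
    generalize #{u ∈ S | ¬ u i = true} = c at *
    push_cast at ih₁ ih₂ ⊢
    rcases le_total a c with h | h
    · have hnum := mul_logb_two_add_mul_logb_two_add_le (a := a) (c := c)
        (Nat.cast_nonneg a) (by exact_mod_cast h)
      have : (#(pairedPoints i S) : ℝ) ≤ 2 * a := by
        rw [min_eq_left h] at hself; exact_mod_cast hself
      linarith
    · have hnum := mul_logb_two_add_mul_logb_two_add_le (a := c) (c := a)
        (Nat.cast_nonneg c) (by exact_mod_cast h)
      have : (#(pairedPoints i S) : ℝ) ≤ 2 * c := by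
        rw [min_eq_right h] at hself; exact_mod_cast hself
      rw [add_comm (a : ℝ) c]
      linarith

lemma card_mul_two_pow_le_sum_card_pairedPoints {κ : Type*} [Fintype κ]
    (E : κ → Finset (ι → Bool))
    (hcover : ∀ u v : ι → Bool, hammingDist u v = 1 → ∃ k, u ∈ E k ∧ v ∈ E k) :
    Fintype.card ι * 2 ^ Fintype.card ι ≤ ∑ k, ∑ i, #(pairedPoints i (E k)) := by
  rw [sum_comm]
  have hdir (i : ι) : 2 ^ Fintype.card ι ≤ ∑ k, #(pairedPoints i (E k)) := by
    have huniv : (univ : Finset (ι → Bool)) ⊆ univ.biUnion fun k ↦ pairedPoints i (E k) := by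
      intro u _
      simpa using hcover u _ (hammingDist_flipCoord i u)
    simpa using (card_le_card huniv).trans card_biUnion_le
  simpa using card_nsmul_le_sum univ _ _ fun i _ ↦ hdir i

end Hypercube

/-- Theorem 3.2: for any mapping schema `E₁, …, E_p` for the Hamming-distance-1 problem on
strings of length `b ≥ 1` in which each reducer receives at most `q ≥ 2` inputs, the
replication rate `(∑ᵢ |Eᵢ|)/2^b` is at least `b / log₂ q`. -/
theorem hamming_distance_one_replication_lower_bound (b q p : ℕ) (hb : 1 ≤ b) (hq : 2 ≤ q)
    (E : Fin p → Finset (Fin b → Bool))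
    (hsize : ∀ i, (E i).card ≤ q)
    (hcover : ∀ u v : Fin b → Bool, hammingDist u v = 1 → ∃ i, u ∈ E i ∧ v ∈ E i) :
    (b : ℝ) / Real.logb 2 q ≤ (∑ i, ((E i).card : ℝ)) / 2 ^ b := by
  have hlog : 0 < Real.logb 2 q :=
    Real.logb_pos (by norm_num) (by exact_mod_cast hq)
  rw [div_le_div_iff₀ hlog (by positivity), sum_mul]
  have hcount : (b : ℝ) * 2 ^ b ≤ ∑ k, ((∑ i, #(pairedPoints i (E k)) : ℕ) : ℝ) := by
    have h := card_mul_two_pow_le_sum_card_pairedPoints E hcover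
    rw [Fintype.card_fin] at h
    exact_mod_cast h
  refine hcount.trans (sum_le_sum fun k _ ↦ (sum_card_pairedPoints_le univ (E k)).trans ?_)
  rcases (E k).eq_empty_or_nonempty with hE | hE
  · simp [hE]
  · have hpos : (0 : ℝ) < #(E k) := by exact_mod_cast hE.card_pos
    exact mul_le_mul_of_nonneg_left
      (Real.logb_le_logb_of_le (by norm_num) hpos (by exact_mod_cast hsize k)) hpos.le
end

section
/- Let b = r·m with r ≥ 1 and m ≥ 1. There exists a finite family of subsets of the set of binary strings of length b such that: (i) each subset in the family has exactly 2^m elements; (ii) every binary string of length b belongs to exactly r subsets of the family; and (iii) every unordered pair of binary strings at Hamming distance exactly 1 is contained together in at least one subset of the family. -/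
/-- The subcube of functions `ι → Bool` whose restriction to the complement of `{j | p j}` is `y`. -/
def subcube {ι : Type*} [Fintype ι] [DecidableEq ι] (p : ι → Prop) [DecidablePred p]
    (y : {j // ¬ p j} → Bool) : Finset (ι → Bool) :=
  Finset.univ.filter fun w => (fun j : {j // ¬ p j} => w j) = y

theorem mem_subcube {ι : Type*} [Fintype ι] [DecidableEq ι] {p : ι → Prop} [DecidablePred p]
    {y : {j // ¬ p j} → Bool} {w : ι → Bool} :
    w ∈ subcube p y ↔ (fun j : {j // ¬ p j} => w j) = y := by
  simp [subcube]

theorem card_subcube {ι : Type*} [Fintype ι] [DecidableEq ι] (p : ι → Prop) [DecidablePred p]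
    (y : {j // ¬ p j} → Bool) : (subcube p y).card = 2 ^ Fintype.card {j // p j} := by
  let e := Equiv.piEquivPiSubtypeProd p fun _ => Bool
  have h : subcube p y = Finset.univ.image fun x => e.symm (x, y) := by
    ext w
    simp only [mem_subcube, Finset.mem_image, Finset.mem_univ, true_and]
    constructor
    · rintro rfl
      exact ⟨(e w).1, e.symm_apply_apply w⟩
    · rintro ⟨x, rfl⟩
      exact congrArg Prod.snd (e.apply_symm_apply (x, y))
  rw [h, Finset.card_image_of_injective _ fun x x' hx => congrArg Prod.fst (e.symm.injective hx)]
  simp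

theorem exists_forall_ne_eq_of_hammingDist_eq_one {ι : Type*} [Fintype ι] {β : ι → Type*}
    [∀ i, DecidableEq (β i)] {u v : ∀ i, β i} (h : hammingDist u v = 1) :
    ∃ j, ∀ k, k ≠ j → u k = v k := by
  obtain ⟨j, hj⟩ := Finset.card_eq_one.mp h
  refine ⟨j, fun k hk => ?_⟩
  by_contra hne
  exact hk (Finset.mem_singleton.mp (hj ▸ Finset.mem_filter.mpr ⟨Finset.mem_univ k, hne⟩))

/-- The `i`-th block of `Fin (r * m)` has `m` indices. -/
theorem card_finProdFinEquiv_symm_fst_eq (r m : ℕ) (i : Fin r) :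
    Fintype.card {j : Fin (r * m) // (finProdFinEquiv.symm j).1 = i} = m := by
  rw [Fintype.card_congr (finProdFinEquiv.symm.subtypeEquiv
    (q := fun x : Fin r × Fin m => x.1 = i) fun _ => Iff.rfl),
    Fintype.card_congr (Equiv.prodSubtypeFstEquivSubtypeProd (p := fun a : Fin r => a = i))]
  simp

/-- Existence of the generalized Splitting mapping schema: for `b = r·m` there is a finite
family of sets of binary strings of length `b` such that (i) each set has exactly `2^m`
elements, (ii) every string belongs to exactly `r` sets of the family, and (iii) every
unordered pair of strings at Hamming distance exactly 1 lies together in some set. -/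
theorem splitting_schema_exists (r m : ℕ) (hr : 1 ≤ r) (hm : 1 ≤ m) :
    ∃ (N : ℕ) (F : Fin N → Finset (Fin (r * m) → Bool)),
      (∀ i, (F i).card = 2 ^ m) ∧
      (∀ w : Fin (r * m) → Bool, (Finset.univ.filter (fun i => w ∈ F i)).card = r) ∧
      (∀ u v : Fin (r * m) → Bool, hammingDist u v = 1 → ∃ i, u ∈ F i ∧ v ∈ F i) := by
  classical
  let p (i : Fin r) (j : Fin (r * m)) : Prop := (finProdFinEquiv.symm j).1 = i
  let J := Σ i : Fin r, ({j // ¬ p i j} → Bool)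
  let G (x : J) : Finset (Fin (r * m) → Bool) := subcube (p x.1) x.2
  let e : J ≃ Fin (Fintype.card J) := Fintype.equivFin J
  refine ⟨Fintype.card J, fun n => G (e.symm n), fun n => ?_, fun w => ?_, fun u v huv => ?_⟩
  · exact (card_subcube _ _).trans
      (congrArg (2 ^ ·) ((Fintype.card_congr (Equiv.refl _)).trans
        (card_finProdFinEquiv_symm_fst_eq r m (e.symm n).1)))
  · let s (i : Fin r) : J := ⟨i, fun j => w j⟩
    have hs : Function.Injective fun i => e (s i) := fun i i' h =>
      congrArg Sigma.fst (e.injective h)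
    have h : Finset.univ.filter (fun n => w ∈ G (e.symm n)) =
        Finset.univ.image fun i => e (s i) := by
      ext n
      obtain ⟨⟨i, y⟩, rfl⟩ := e.surjective n
      simp only [Finset.mem_filter, Finset.mem_univ, true_and, Equiv.symm_apply_apply,
        Finset.mem_image, e.injective.eq_iff]
      refine mem_subcube.trans ⟨fun h => ⟨i, congrArg (Sigma.mk i) h⟩, ?_⟩
      rintro ⟨i', h⟩
      cases h
      rfl
    rw [h, Finset.card_image_of_injective _ hs, Finset.card_univ, Fintype.card_fin]
  · obtain ⟨j, hj⟩ := exists_forall_ne_eq_of_hammingDist_eq_one huv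
    let x : J := ⟨(finProdFinEquiv.symm j).1, fun k => v k⟩
    refine ⟨e x, ?_, ?_⟩ <;> simp only [Equiv.symm_apply_apply] <;> refine mem_subcube.mpr ?_
    · funext k
      exact hj k fun hk => k.2 (congrArg (fun l => (finProdFinEquiv.symm l).1) hk)
    · rfl
end

section
/- Every finite simple graph with m edges contains at most (√2/3)·m^(3/2) triangles, where a triangle is an unordered set of three vertices that are pairwise adjacent. -/
namespace SimpleGraph

open Finset

variable {V : Type*} [Fintype V] (G : SimpleGraph V) [DecidableRel G.Adj]

/-- The ordered pairs of adjacent vertices. -/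
def adjPairs : Finset (V × V) := {p | G.Adj p.1 p.2}

/-- The ordered triples of pairwise adjacent vertices. -/
def adjTriples : Finset ((V × V) × V) := {t | G.Adj t.1.1 t.1.2 ∧ G.Adj t.1.1 t.2 ∧ G.Adj t.1.2 t.2}

theorem mem_adjPairs {p : V × V} : p ∈ G.adjPairs ↔ G.Adj p.1 p.2 := by
  simp [adjPairs]

theorem mem_adjTriples {t : (V × V) × V} :
    t ∈ G.adjTriples ↔ G.Adj t.1.1 t.1.2 ∧ G.Adj t.1.1 t.2 ∧ G.Adj t.1.2 t.2 := by
  simp [adjTriples]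

theorem card_adjPairs : #G.adjPairs = 2 * #G.edgeFinset := by
  rw [← G.sum_degrees_eq_twice_card_edges, adjPairs, card_filter, Fintype.sum_prod_type]
  refine sum_congr rfl fun v _ => ?_
  rw [← card_filter, ← G.card_neighborFinset_eq_degree, G.neighborFinset_eq_filter]

theorem card_adjTriples :
    #G.adjTriples = ∑ p ∈ G.adjPairs, #{w | G.Adj p.1 w ∧ G.Adj p.2 w} := by
  rw [adjTriples, card_filter, Fintype.sum_prod_type, adjPairs, sum_filter]
  refine sum_congr rfl fun p _ => ?_
  rw [← card_filter]
  split_ifs with h <;> simp [h]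

theorem sum_card_commonNeighbors_sq_le :
    ∑ p ∈ G.adjPairs, #{w | G.Adj p.1 w ∧ G.Adj p.2 w} ^ 2 ≤ #G.adjPairs ^ 2 := by
  simp_rw [sq, ← card_product]
  rw [← card_sigma]
  refine card_le_card_of_injOn (fun x => ((x.1.1, x.2.1), (x.1.2, x.2.2))) ?_ ?_
  · rintro ⟨⟨u, v⟩, w, x⟩ h
    simp only [coe_sigma, Set.mem_sigma_iff, mem_coe, mem_product, mem_filter, mem_univ,
      true_and, mem_adjPairs] at h ⊢
    exact ⟨h.2.1.1, h.2.2.2⟩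
  · rintro ⟨⟨u, v⟩, w, x⟩ - ⟨⟨u', v'⟩, w', x'⟩ - h
    simp only [Prod.mk.injEq] at h
    obtain ⟨⟨rfl, rfl⟩, rfl, rfl⟩ := h
    rfl

theorem card_adjTriples_sq_le : #G.adjTriples ^ 2 ≤ (2 * #G.edgeFinset) ^ 3 := by
  rw [← card_adjPairs, card_adjTriples]
  calc _ ≤ #G.adjPairs * ∑ p ∈ G.adjPairs, #{w | G.Adj p.1 w ∧ G.Adj p.2 w} ^ 2 :=
        sq_sum_le_card_mul_sum_sq
    _ ≤ #G.adjPairs * #G.adjPairs ^ 2 := Nat.mul_le_mul_left _ G.sum_card_commonNeighbors_sq_le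
    _ = #G.adjPairs ^ 3 := by ring

theorem six_mul_card_cliqueFinset_three_le [DecidableEq V] :
    6 * #(G.cliqueFinset 3) ≤ #G.adjTriples := by
  have hmaps : ∀ t ∈ G.adjTriples, ({t.1.1, t.1.2, t.2} : Finset V) ∈ G.cliqueFinset 3 := by
    intro t ht
    rw [mem_adjTriples] at ht
    exact (G.mem_cliqueFinset_iff).2 (is3Clique_triple_iff.2 ht)
  rw [card_eq_sum_card_fiberwise hmaps, mul_comm, ← smul_eq_mul]
  refine card_nsmul_le_sum _ _ _ fun s hs => ?_
  obtain ⟨a, b, c, hab, hac, hbc, rfl⟩ := is3Clique_iff.1 ((G.mem_cliqueFinset_iff).1 hs)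
  have hsix : #({((a, b), c), ((a, c), b), ((b, a), c), ((b, c), a), ((c, a), b), ((c, b), a)} :
      Finset ((V × V) × V)) = 6 := by
    simp [hab.ne, hac.ne, hbc.ne, hab.ne', hac.ne', hbc.ne']
  rw [← hsix]
  refine card_le_card fun t ht => ?_
  rw [mem_filter, mem_adjTriples]
  simp only [mem_insert, mem_singleton] at ht
  rcases ht with rfl | rfl | rfl | rfl | rfl | rfl <;>
    refine ⟨by simp [hab, hac, hbc, hab.symm, hac.symm, hbc.symm], ?_⟩ <;> ext x <;>
    simp only [mem_insert, mem_singleton] <;> tauto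

end SimpleGraph

/-- Every finite simple graph with `m` edges contains at most `(√2/3)·m^(3/2)` triangles
(3-cliques). -/
theorem triangle_count_bound (V : Type) [Fintype V] [DecidableEq V]
    (G : SimpleGraph V) [DecidableRel G.Adj] (m : ℕ) (hm : G.edgeFinset.card = m) :
    ((G.cliqueFinset 3).card : ℝ) ≤ Real.sqrt 2 / 3 * (m : ℝ) ^ ((3 : ℝ) / 2) := by
  have hsq : (6 * (G.cliqueFinset 3).card) ^ 2 ≤ (2 * m) ^ 3 :=
    (Nat.pow_le_pow_left G.six_mul_card_cliqueFinset_three_le 2).trans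
      (hm ▸ G.card_adjTriples_sq_le)
  have hsq' : (6 * ((G.cliqueFinset 3).card : ℝ)) ^ 2 ≤ (2 * m) ^ 3 := by exact_mod_cast hsq
  have hpow : ((m : ℝ) ^ ((3 : ℝ) / 2)) ^ 2 = (m : ℝ) ^ 3 := by
    rw [← Real.rpow_mul_natCast (Nat.cast_nonneg m), ← Real.rpow_natCast]
    norm_num
  refine (abs_le_of_sq_le_sq' ?_ (by positivity)).2
  rw [mul_pow, div_pow, hpow, Real.sq_sqrt zero_le_two]
  linarith
end

section
/- Let n ≥ 3 and q ≥ 1. Suppose E₁, …, E_p are finitely many sets of edges of the complete graph on n vertices (i.e., sets of unordered pairs of distinct elements of Fin n), each of size |Eᵢ| ≤ q, such that for every set of three distinct vertices, all three edges among them lie in some single Eᵢ. If every graph with at most q edges contains at most (√2/3)·q^(3/2) triangles, then ∑ᵢ |Eᵢ| ≥ 3·C(n,3)/√(2q); equivalently, the replication rate r = (∑ᵢ |Eᵢ|)/C(n,2) satisfies r ≥ (n−2)/√(2q). -/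
/-- The number of ordered pairs whose underlying unordered pair lies in `A` is at most `2 |A|`. -/
theorem sum_pair_indicator_le {V : Type*} [Fintype V] [DecidableEq V] (A : Finset (Sym2 V)) :
    (∑ a, ∑ b, if s(a, b) ∈ A then (1 : ℝ) else 0) ≤ 2 * (A.card : ℝ) := by
  rw [← Fintype.sum_prod_type' (fun a b : V => if s(a, b) ∈ A then (1 : ℝ) else 0),
    Finset.sum_boole]
  have h : (Finset.univ.filter (fun x : V × V => s(x.1, x.2) ∈ A)).card ≤ 2 * A.card := by
    refine Finset.card_le_mul_card_image_of_maps_to (f := fun x : V × V => s(x.1, x.2))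
      (fun x hx => (Finset.mem_filter.1 hx).2) 2 ?_
    intro e _
    induction e using Sym2.ind with
    | _ a b =>
      refine (Finset.card_le_card (t := {(a, b), (b, a)}) ?_).trans Finset.card_le_two
      rintro ⟨x, y⟩ hx
      simpa using (Finset.mem_filter.1 hx).2
  exact_mod_cast h

/-- The trace of `w * w * wᵀ` is at most the cube of the Frobenius norm of the matrix `w`. -/
theorem sum_triple_sq_le {V : Type*} [Fintype V] (w : V → V → ℝ) :
    (∑ a, ∑ b, ∑ c, w a b * (w a c * w b c)) ^ 2 ≤ (∑ a, ∑ b, w a b ^ 2) ^ 3 := by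
  have hw : ∑ a, ∑ b, ∑ c, w a b * (w a c * w b c) =
      ∑ x : V × V, w x.1 x.2 * ∑ c, w x.1 c * w x.2 c := by
    simp only [Fintype.sum_prod_type, Finset.mul_sum]
  have hsq : ∑ x : V × V, (∑ c, w x.1 c * w x.2 c) ^ 2 ≤ (∑ a, ∑ b, w a b ^ 2) ^ 2 := by
    calc ∑ x : V × V, (∑ c, w x.1 c * w x.2 c) ^ 2
        ≤ ∑ x : V × V, (∑ c, w x.1 c ^ 2) * ∑ c, w x.2 c ^ 2 :=
          Finset.sum_le_sum fun x _ => Finset.sum_mul_sq_le_sq_mul_sq _ _ _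
      _ = (∑ a, ∑ b, w a b ^ 2) ^ 2 := by
          rw [Fintype.sum_prod_type, sq, Finset.sum_mul_sum]
  calc (∑ a, ∑ b, ∑ c, w a b * (w a c * w b c)) ^ 2
      ≤ (∑ x : V × V, w x.1 x.2 ^ 2) * ∑ x : V × V, (∑ c, w x.1 c * w x.2 c) ^ 2 := by
        rw [hw]
        exact Finset.sum_mul_sq_le_sq_mul_sq _ _ _
    _ ≤ (∑ x : V × V, w x.1 x.2 ^ 2) * (∑ a, ∑ b, w a b ^ 2) ^ 2 := by gcongr
    _ = (∑ a, ∑ b, w a b ^ 2) ^ 3 := by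
        rw [Fintype.sum_prod_type]
        ring

/-- The number of ordered triangles of a graph with edge set `A` is at most `(2 |A|) ^ (3 / 2)`. -/
theorem sum_triangle_indicator_le {V : Type*} [Fintype V] [DecidableEq V] (A : Finset (Sym2 V)) :
    (∑ a, ∑ b, ∑ c, if s(a, b) ∈ A ∧ s(a, c) ∈ A ∧ s(b, c) ∈ A then (1 : ℝ) else 0) ≤
      2 * (A.card : ℝ) * Real.sqrt (2 * A.card) := by
  have hprod : ∀ P Q R : Prop, [Decidable P] → [Decidable Q] → [Decidable R] →
      (if P then (1 : ℝ) else 0) * ((if Q then 1 else 0) * if R then 1 else 0) =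
        if P ∧ Q ∧ R then 1 else 0 := by
    intro P Q R _ _ _
    by_cases P <;> by_cases Q <;> by_cases R <;> simp_all
  have h := sum_triple_sq_le (fun a b : V => if s(a, b) ∈ A then (1 : ℝ) else 0)
  simp only [ite_pow, one_pow, ne_eq, OfNat.ofNat_ne_zero, not_false_eq_true, zero_pow,
    hprod] at h
  refine le_of_sq_le_sq (h.trans ?_) (by positivity)
  rw [mul_pow, Real.sq_sqrt (by positivity), ← pow_succ]
  refine pow_le_pow_left₀ ?_ (sum_pair_indicator_le A) 3
  exact Finset.sum_nonneg fun a _ => Finset.sum_nonneg fun b _ => by split_ifs <;> norm_num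

/-- The number of ordered triples of distinct elements of an `n`-element type. -/
theorem sum_distinct_triple_indicator {V : Type*} [Fintype V] [DecidableEq V] :
    (∑ a : V, ∑ b : V, ∑ c : V, if a ≠ b ∧ a ≠ c ∧ b ≠ c then (1 : ℝ) else 0) =
      (Fintype.card V : ℝ) * (Fintype.card V - 1) * (Fintype.card V - 2) := by
  have h : ∀ a b c : V, (if a ≠ b ∧ a ≠ c ∧ b ≠ c then (1 : ℝ) else 0) =
      1 - (if a = b then 1 else 0) - (if a = c then 1 else 0) - (if b = c then 1 else 0)
        + 2 * (if a = b then (if a = c then 1 else 0) else 0) := by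
    intro a b c
    by_cases hab : a = b <;> by_cases hac : a = c <;> by_cases hbc : b = c <;>
      first | (simp_all; done) | (simp_all; norm_num)
  simp only [h, Finset.sum_add_distrib, Finset.sum_sub_distrib, ← Finset.mul_sum]
  simp
  ring

/-- The replication-rate lower bound for triangle finding. Given a mapping schema
`E₁, …, E_p` of edge sets of the complete graph on `n ≥ 3` vertices, each of size at most
`q ≥ 1`, covering every triangle, and assuming that every graph with at most `q` edges has at
most `(√2/3)·q^(3/2)` triangles, we get `∑ᵢ |Eᵢ| ≥ 3·C(n,3)/√(2q)`; equivalently the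
replication rate `(∑ᵢ |Eᵢ|)/C(n,2)` is at least `(n-2)/√(2q)`. -/
theorem triangle_replication_lower_bound (n q p : ℕ) (hn : 3 ≤ n) (hq : 1 ≤ q)
    (E : Fin p → Finset (Sym2 (Fin n)))
    (hedges : ∀ i, ∀ e ∈ E i, ¬ e.IsDiag)
    (hsize : ∀ i, (E i).card ≤ q)
    (hcover : ∀ a b c : Fin n, a ≠ b → a ≠ c → b ≠ c →
      ∃ i, s(a, b) ∈ E i ∧ s(a, c) ∈ E i ∧ s(b, c) ∈ E i)
    (hbound : ∀ (V : Type) [Fintype V] [DecidableEq V] (A : Finset (Sym2 V)),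
      (∀ e ∈ A, ¬ e.IsDiag) → A.card ≤ q →
      ((((Finset.univ : Finset V).powersetCard 3).filter
          (fun t => ∀ a ∈ t, ∀ b ∈ t, a ≠ b → s(a, b) ∈ A)).card : ℝ)
        ≤ Real.sqrt 2 / 3 * (q : ℝ) ^ ((3 : ℝ) / 2)) :
    3 * (n.choose 3 : ℝ) / Real.sqrt (2 * q) ≤ (∑ i, ((E i).card : ℝ)) ∧
    ((n : ℝ) - 2) / Real.sqrt (2 * q) ≤ (∑ i, ((E i).card : ℝ)) / (n.choose 2 : ℝ) := by
  have hq' : (0 : ℝ) < Real.sqrt (2 * q) := Real.sqrt_pos.2 (by positivity)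
  have hn' : (3 : ℝ) ≤ n := by exact_mod_cast hn
  have hcount : (n : ℝ) * (n - 1) * (n - 2) ≤
      2 * Real.sqrt (2 * q) * ∑ i, ((E i).card : ℝ) := by
    calc (n : ℝ) * (n - 1) * (n - 2)
        = ∑ a : Fin n, ∑ b : Fin n, ∑ c : Fin n,
            if a ≠ b ∧ a ≠ c ∧ b ≠ c then (1 : ℝ) else 0 := by
          rw [sum_distinct_triple_indicator, Fintype.card_fin]
      _ ≤ ∑ a : Fin n, ∑ b : Fin n, ∑ c : Fin n, ∑ i,
            if s(a, b) ∈ E i ∧ s(a, c) ∈ E i ∧ s(b, c) ∈ E i then (1 : ℝ) else 0 := by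
          refine Finset.sum_le_sum fun a _ => Finset.sum_le_sum fun b _ =>
            Finset.sum_le_sum fun c _ => ?_
          have hnonneg : ∀ i ∈ Finset.univ, (0 : ℝ) ≤
              if s(a, b) ∈ E i ∧ s(a, c) ∈ E i ∧ s(b, c) ∈ E i then (1 : ℝ) else 0 :=
            fun i _ => by split_ifs <;> norm_num
          split_ifs with h
          · obtain ⟨i, hi⟩ := hcover a b c h.1 h.2.1 h.2.2
            have hle := Finset.single_le_sum hnonneg (Finset.mem_univ i)
            rwa [if_pos hi] at hle
          · exact Finset.sum_nonneg hnonneg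
      _ = ∑ i, ∑ a : Fin n, ∑ b : Fin n, ∑ c : Fin n,
            if s(a, b) ∈ E i ∧ s(a, c) ∈ E i ∧ s(b, c) ∈ E i then (1 : ℝ) else 0 := by
          simp only [Finset.sum_comm (t := (Finset.univ : Finset (Fin p)))]
      _ ≤ ∑ i, 2 * Real.sqrt (2 * q) * ((E i).card : ℝ) := by
          refine Finset.sum_le_sum fun i _ => (sum_triangle_indicator_le (E i)).trans ?_
          have hi : ((E i).card : ℝ) ≤ q := by exact_mod_cast hsize i
          rw [mul_right_comm]
          gcongr
      _ = 2 * Real.sqrt (2 * q) * ∑ i, ((E i).card : ℝ) := by rw [Finset.mul_sum]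
  have hchoose₂ : (n.choose 2 : ℝ) = n * (n - 1) / 2 := Nat.cast_choose_two ℝ n
  have hchoose₃ : (n.choose 3 : ℝ) = n * (n - 1) * (n - 2) / 6 := by
    obtain ⟨m, rfl⟩ : ∃ m, n = m + 1 := ⟨n - 1, by omega⟩
    have h : ((m : ℝ) + 1) * m.choose 2 = (m + 1).choose 3 * 3 := by
      exact_mod_cast Nat.add_one_mul_choose_eq m 2
    rw [Nat.cast_choose_two] at h
    push_cast
    linarith
  constructor
  · rw [div_le_iff₀ hq', hchoose₃]
    linarith
  · rw [hchoose₂, div_le_div_iff₀ hq' (by nlinarith)]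
    linarith
end
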